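/- Let b ∈ B(k) and 1 ≤ j ≤ i ≤ n. Then: (0) the vectors b·e_1, …, b·e_{j−1}, e_j, b·e_{j+1}, …, b·e_i, e_{i+1}, …, e_n form a basis of k^n; letting π be the unique k-linear endomorphism of k^n vanishing on all of these basis vectors except that π(e_j) = e_i, one has: (a) π(e_ℓ) = 0 for every ℓ < j and every ℓ > i; (b) the image of π is contained in the line k·e_i; (c) setting c := c_{i,j} and, for 0 ≤ ℓ ≤ n, W_ℓ := span(e_{c⁻¹(1)}, …, e_{c⁻¹(ℓ)}), one has (b⁻¹∘π∘b)(W_ℓ) = 0 for every ℓ < i and (b⁻¹∘π∘b)(W_ℓ) = k·b⁻¹(e_i) ⊆ W_i for every ℓ ≥ i; in particular the endomorphism b⁻¹∘π∘b stabilizes each subspace W_ℓ. -/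

import Mathlib

/-- `c` is the full cycle `c_{i,j} = (i, i-1, …, j+1, j)` (for `j ≤ i`): it sends
`j` to `i`, sends `a` to `a - 1` for `j < a ≤ i`, and fixes all other points. -/
def IsFullCycleAt {n : ℕ} (c : Equiv.Perm (Fin n)) (i j : Fin n) : Prop :=
  c j = i ∧ (∀ a : Fin n, j < a → a ≤ i → (c a : ℕ) = (a : ℕ) - 1) ∧
    ∀ a : Fin n, ¬(j ≤ a ∧ a ≤ i) → c a = a

/-- The family of vectors
`b e_1, …, b e_{j-1}, e_j, b e_{j+1}, …, b e_i, e_{i+1}, …, e_n` of `k^n`. -/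
def basisFam {n : ℕ} {k : Type*} [Field k] (b : Matrix (Fin n) (Fin n) k)
    (i j : Fin n) : Fin n → (Fin n → k) :=
  fun ℓ => if ℓ = j ∨ i < ℓ then Pi.single ℓ 1 else b.mulVec (Pi.single ℓ 1)

/-- `π` is the linear endomorphism of `k^n` vanishing on all the vectors of the
family `basisFam b i j` except that `π (e_j) = e_i`. -/
def IsPiMap {n : ℕ} {k : Type*} [Field k] (b : Matrix (Fin n) (Fin n) k)
    (i j : Fin n) (π : (Fin n → k) →ₗ[k] (Fin n → k)) : Prop :=
  (∀ ℓ : Fin n, ℓ ≠ j → π (basisFam b i j ℓ) = 0) ∧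
    π (basisFam b i j j) = Pi.single i 1

/-- `W_ℓ = span(e_{c⁻¹(1)}, …, e_{c⁻¹(ℓ)})` (0-indexed: the span of the
`Pi.single (c⁻¹ m) 1` for `m < ℓ`). -/
def flagW {n : ℕ} (k : Type*) [Field k] (c : Equiv.Perm (Fin n)) (ℓ : ℕ) :
    Submodule k (Fin n → k) :=
  Submodule.span k {x : Fin n → k | ∃ m : Fin n, (m : ℕ) < ℓ ∧ x = Pi.single (c⁻¹ m) 1}

lemma isFullCycleAt_inv_cycleIcc {n : ℕ} [NeZero n] {i j : Fin n} (hij : j ≤ i) :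
    IsFullCycleAt (Fin.cycleIcc j i)⁻¹ i j := by
  refine ⟨?_, fun a hja hai => ?_, fun a ha => ?_⟩
  · rw [Equiv.Perm.inv_eq_iff_eq, Fin.cycleIcc_of_last hij]
  · have hlt : (a : ℕ) - 1 < n := by omega
    have h : (Fin.cycleIcc j i)⁻¹ a = ⟨(a : ℕ) - 1, hlt⟩ := by
      rw [Equiv.Perm.inv_eq_iff_eq, Fin.cycleIcc_of_ge_of_lt (Fin.le_def.2 (by simp; omega))
        (Fin.lt_def.2 (by simp; omega))]
      ext
      rw [Fin.val_add_one_of_lt' (by simp; omega)]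
      simp
      omega
    rw [h]
  · rw [Equiv.Perm.inv_eq_iff_eq]
    rcases lt_or_ge a j with h | h
    · exact (Fin.cycleIcc_of_lt h).symm
    · exact (Fin.cycleIcc_of_gt (not_le.1 fun h' => ha ⟨h, h'⟩)).symm

lemma IsFullCycleAt.apply_le {n : ℕ} {c : Equiv.Perm (Fin n)} {i j a : Fin n}
    (hc : IsFullCycleAt c i j) (ha : a ≤ i) : c a ≤ i := by
  rcases lt_trichotomy a j with h | rfl | h
  · rwa [hc.2.2 a fun h' => h'.1.not_gt h]
  · exact hc.1.le
  · rw [Fin.le_def, hc.2.1 a h ha]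
    omega

lemma IsFullCycleAt.inv_apply_le {n : ℕ} {c : Equiv.Perm (Fin n)} {i j m : Fin n}
    (hc : IsFullCycleAt c i j) (hm : m ≤ i) : c⁻¹ m ≤ i := by
  by_contra! h
  have := hc.2.2 (c⁻¹ m) fun h' => h'.2.not_gt h
  rw [show c (c⁻¹ m) = m from c.apply_symm_apply m] at this
  exact (this ▸ hm).not_gt h

lemma IsFullCycleAt.inv_apply {n : ℕ} {c : Equiv.Perm (Fin n)} {i j : Fin n}
    (hc : IsFullCycleAt c i j) : c⁻¹ i = j := by
  rw [Equiv.Perm.inv_eq_iff_eq, hc.1]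

lemma flagW_mono {n : ℕ} (k : Type*) [Field k] (c : Equiv.Perm (Fin n)) :
    Monotone (flagW k c) := fun _ _ h =>
  Submodule.span_mono fun _ ⟨m, hm, hx⟩ => ⟨m, hm.trans_le h, hx⟩

section UpperTriangular

variable {n : ℕ} {k : Type*} [Field k] {b b' : Matrix (Fin n) (Fin n) k}

lemma Matrix.IsUpperTriangular.of_mul_eq_one (hbu : b.IsUpperTriangular) (h : b * b' = 1) :
    b'.IsUpperTriangular := by
  have := invertibleOfRightInverse b b' h
  rw [← Matrix.inv_eq_right_inv h]
  exact Matrix.blockTriangular_inv_of_blockTriangular hbu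

lemma Matrix.IsUpperTriangular.diag_ne_zero (hbu : b.IsUpperTriangular) (h : b * b' = 1)
    (a : Fin n) : b a a ≠ 0 := by
  have hdet : b.det ≠ 0 := fun h0 => by
    simpa [h0] using congrArg Matrix.det h
  rw [Matrix.det_of_isUpperTriangular hbu] at hdet
  exact Finset.prod_ne_zero_iff.1 hdet a (Finset.mem_univ a)

/-- A linear map sends column `ℓ` of an upper triangular matrix to a combination of its values
on `e_1, …, e_ℓ`. -/
lemma Matrix.IsUpperTriangular.map_col_mem {V : Type*} [AddCommGroup V] [Module k V]
    (hbu : b.IsUpperTriangular) (f : (Fin n → k) →ₗ[k] V) (P : Submodule k V) {ℓ : Fin n}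
    (hf : ∀ a ≤ ℓ, f (Pi.single a 1) ∈ P) : f (b.mulVec (Pi.single ℓ 1)) ∈ P := by
  rw [Matrix.mulVec_single_one, pi_eq_sum_univ' (b.col ℓ), map_sum]
  refine Submodule.sum_mem _ fun a _ => ?_
  rw [map_smul]
  rcases le_or_gt a ℓ with h | h
  · exact P.smul_mem _ (hf a h)
  · simp [Matrix.col_apply, hbu h]

lemma linearIndependent_basisFam (hbu : b.IsUpperTriangular) (h : b * b' = 1) (i j : Fin n) :
    LinearIndependent k (basisFam b i j) := by
  let A : Matrix (Fin n) (Fin n) k := Matrix.of fun a ℓ => basisFam b i j ℓ a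
  have hA : A.IsUpperTriangular := fun a ℓ (hℓ : ℓ < a) => by
    by_cases hc : ℓ = j ∨ i < ℓ
    · simp [A, basisFam, hc, hℓ.ne']
    · simp [A, basisFam, hc, Matrix.col_apply, hbu hℓ]
  refine Matrix.linearIndependent_cols_of_det_ne_zero (A := A) ?_
  rw [Matrix.det_of_isUpperTriangular hA, Finset.prod_ne_zero_iff]
  intro a _
  by_cases hc : a = j ∨ i < a
  · simp [A, basisFam, hc]
  · simp [A, basisFam, hc, Matrix.col_apply, hbu.diag_ne_zero h a]

lemma span_range_basisFam (hbu : b.IsUpperTriangular) (h : b * b' = 1) (i j : Fin n) :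
    Submodule.span k (Set.range (basisFam b i j)) = ⊤ :=
  (linearIndependent_basisFam hbu h i j).span_eq_top_of_card_eq_finrank' (by simp)

lemma existsUnique_isPiMap (hbu : b.IsUpperTriangular) (h : b * b' = 1) (i j : Fin n) :
    ∃! π : (Fin n → k) →ₗ[k] (Fin n → k), IsPiMap b i j π := by
  let B := Module.Basis.mk (linearIndependent_basisFam hbu h i j)
    (span_range_basisFam hbu h i j).ge
  have hB : ∀ ℓ, B ℓ = basisFam b i j ℓ := Module.Basis.mk_apply _ _
  refine ⟨B.constr k fun ℓ => if ℓ = j then Pi.single i 1 else 0, ⟨fun ℓ hℓ => ?_, ?_⟩,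
    fun π hπ => B.ext fun ℓ => ?_⟩
  · rw [← hB, Module.Basis.constr_basis, if_neg hℓ]
  · rw [← hB, Module.Basis.constr_basis, if_pos rfl]
  · rw [Module.Basis.constr_basis, hB]
    split_ifs with hℓ
    · rw [hℓ, hπ.2]
    · exact hπ.1 ℓ hℓ

namespace IsPiMap

variable {i j : Fin n} {π : (Fin n → k) →ₗ[k] (Fin n → k)}

lemma map_single (hπ : IsPiMap b i j π) : π (Pi.single j 1) = Pi.single i 1 := by
  simpa only [basisFam, true_or, if_true] using hπ.2

lemma map_mulVec_single (hπ : IsPiMap b i j π) {ℓ : Fin n} (hi : ℓ ≤ i) (hj : ℓ ≠ j) :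
    π (b.mulVec (Pi.single ℓ 1)) = 0 := by
  simpa only [basisFam, hj, hi.not_gt, or_self, if_false] using hπ.1 ℓ hj

lemma map_single_of_lt (hπ : IsPiMap b i j π) (hbu : b.IsUpperTriangular) (h : b * b' = 1)
    (hij : j ≤ i) {ℓ : Fin n} (hℓ : ℓ < j) : π (Pi.single ℓ 1) = 0 := by
  have key := (hbu.of_mul_eq_one h).map_col_mem (π.comp b.mulVecLin) ⊥ (ℓ := ℓ) fun a ha =>
    (Submodule.mem_bot k).2 (hπ.map_mulVec_single (ha.trans (hℓ.le.trans hij)) (ha.trans_lt hℓ).ne)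
  simpa only [LinearMap.comp_apply, Matrix.mulVecLin_apply, Matrix.mulVec_mulVec, h,
    Matrix.one_mulVec, Submodule.mem_bot] using key

lemma map_single_of_gt (hπ : IsPiMap b i j π) (hij : j ≤ i) {ℓ : Fin n} (hℓ : i < ℓ) :
    π (Pi.single ℓ 1) = 0 := by
  simpa only [basisFam, hℓ, or_true, if_true] using hπ.1 ℓ (hij.trans_lt hℓ).ne'

lemma range_le (hπ : IsPiMap b i j π) (hbu : b.IsUpperTriangular) (h : b * b' = 1) :
    LinearMap.range π ≤ Submodule.span k {Pi.single i (1 : k)} := by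
  rw [LinearMap.range_eq_map, ← span_range_basisFam hbu h i j, Submodule.map_span_le]
  rintro _ ⟨ℓ, rfl⟩
  by_cases hℓ : ℓ = j
  · rw [hℓ, hπ.2]
    exact Submodule.mem_span_singleton_self _
  · rw [hπ.1 ℓ hℓ]
    exact Submodule.zero_mem _

lemma map_mulVec_single_self (hπ : IsPiMap b i j π) (hbu : b.IsUpperTriangular)
    (h : b * b' = 1) (hij : j ≤ i) :
    π (b.mulVec (Pi.single j 1)) = b j j • Pi.single i 1 := by
  rw [Matrix.mulVec_single_one, pi_eq_sum_univ' (b.col j), map_sum, Finset.sum_eq_single j]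
  · rw [map_smul, hπ.map_single, Matrix.col_apply]
  · intro a _ ha
    rw [map_smul]
    rcases ha.lt_or_gt with h' | h'
    · rw [hπ.map_single_of_lt hbu h hij h', smul_zero]
    · simp [Matrix.col_apply, hbu h']
  · simp

lemma map_flagW_eq_bot (hπ : IsPiMap b i j π) {c : Equiv.Perm (Fin n)}
    (hc : IsFullCycleAt c i j) {ℓ : ℕ} (hℓ : ℓ ≤ i) :
    (flagW k c ℓ).map (b'.mulVecLin.comp (π.comp b.mulVecLin)) = ⊥ := by
  rw [eq_bot_iff, flagW, Submodule.map_span_le]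
  rintro _ ⟨m, hm, rfl⟩
  have hmi : m < i := Fin.lt_def.2 (hm.trans_le hℓ)
  have hne : c⁻¹ m ≠ j := fun h' => hmi.ne (c⁻¹.injective (h'.trans hc.inv_apply.symm))
  rw [LinearMap.comp_apply, LinearMap.comp_apply, Matrix.mulVecLin_apply b,
    hπ.map_mulVec_single (hc.inv_apply_le hmi.le) hne, map_zero]
  exact Submodule.zero_mem _

lemma map_flagW_eq_span (hπ : IsPiMap b i j π) (hbu : b.IsUpperTriangular) (h : b * b' = 1)
    (hij : j ≤ i) {c : Equiv.Perm (Fin n)} (hc : IsFullCycleAt c i j) {ℓ : ℕ} (hℓ : i < ℓ) :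
    (flagW k c ℓ).map (b'.mulVecLin.comp (π.comp b.mulVecLin)) =
      Submodule.span k {b'.mulVec (Pi.single i 1)} := by
  apply le_antisymm
  · rintro _ ⟨x, -, rfl⟩
    have hx : π (b.mulVec x) ∈ Submodule.span k {Pi.single i (1 : k)} :=
      hπ.range_le hbu h ⟨_, rfl⟩
    obtain ⟨t, ht⟩ := Submodule.mem_span_singleton.1 hx
    refine Submodule.mem_span_singleton.2 ⟨t, ?_⟩
    rw [LinearMap.comp_apply, LinearMap.comp_apply, Matrix.mulVecLin_apply b, ← ht, map_smul,
      Matrix.mulVecLin_apply]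
  · rw [Submodule.span_singleton_le_iff_mem]
    have hd := hbu.diag_ne_zero h j
    refine ⟨(b j j)⁻¹ • Pi.single j 1, Submodule.smul_mem _ _ (Submodule.subset_span
      ⟨i, hℓ, by rw [hc.inv_apply]⟩), ?_⟩
    rw [map_smul, LinearMap.comp_apply, LinearMap.comp_apply, Matrix.mulVecLin_apply b,
      hπ.map_mulVec_single_self hbu h hij, map_smul, inv_smul_smul₀ hd, Matrix.mulVecLin_apply]

end IsPiMap

lemma span_mulVec_single_le_flagW (hbu : b.IsUpperTriangular) {i j : Fin n}
    {c : Equiv.Perm (Fin n)} (hc : IsFullCycleAt c i j) :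
    Submodule.span k {b.mulVec (Pi.single i (1 : k))} ≤ flagW k c ((i : ℕ) + 1) := by
  rw [Submodule.span_singleton_le_iff_mem]
  refine hbu.map_col_mem LinearMap.id _ fun a ha => Submodule.subset_span ⟨c a, ?_, ?_⟩
  · exact Nat.lt_succ_of_le (Fin.le_def.1 (hc.apply_le ha))
  · rw [LinearMap.id_apply, show c⁻¹ (c a) = a from c.symm_apply_apply a]

end UpperTriangular

/-- Let `b ∈ B(k)` (invertible upper triangular, with inverse `b'`) and
`1 ≤ j ≤ i ≤ n`.  Then: (0) the vectors `b e_1, …, b e_{j-1}, e_j, b e_{j+1}, …,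
b e_i, e_{i+1}, …, e_n` form a basis of `k^n`; letting `π` be the unique linear
endomorphism of `k^n` vanishing on all these basis vectors except `π(e_j) = e_i`,
one has: (a) `π(e_ℓ) = 0` for `ℓ < j` and `ℓ > i`; (b) the image of `π` is
contained in the line `k · e_i`; (c) with `c := c_{i,j}` and
`W_ℓ := span(e_{c⁻¹(1)}, …, e_{c⁻¹(ℓ)})` for `0 ≤ ℓ ≤ n`, one has
`(b⁻¹ ∘ π ∘ b)(W_ℓ) = 0` for every `ℓ < i`, `(b⁻¹ ∘ π ∘ b)(W_ℓ) = k·b⁻¹(e_i) ⊆ W_i`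
for every `ℓ ≥ i`; in particular `b⁻¹ ∘ π ∘ b` stabilizes every `W_ℓ`.
(Indices are 0-indexed in the formal statement, so the 1-indexed conditions
`ℓ < i`, `ℓ ≥ i` become `ℓ ≤ i`, `ℓ > i` and `W_i` becomes `flagW k c (i+1)`.) -/
theorem statement11 {n : ℕ} [NeZero n] {k : Type*} [Field k]
    (b b' : Matrix (Fin n) (Fin n) k) (hbb' : b * b' = 1) (hb'b : b' * b = 1)
    (hbu : ∀ a c : Fin n, c < a → b a c = 0) (i j : Fin n) (hij : j ≤ i) :
    ∃ c : Equiv.Perm (Fin n), IsFullCycleAt c i j ∧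
      LinearIndependent k (basisFam b i j) ∧
      Submodule.span k (Set.range (basisFam b i j)) = ⊤ ∧
      (∃! π : (Fin n → k) →ₗ[k] (Fin n → k), IsPiMap b i j π) ∧
      ∀ π : (Fin n → k) →ₗ[k] (Fin n → k), IsPiMap b i j π →
        (∀ ℓ : Fin n, ℓ < j ∨ i < ℓ → π (Pi.single ℓ 1) = 0) ∧
        LinearMap.range π ≤ Submodule.span k {Pi.single i (1 : k)} ∧
        π (Pi.single j 1) = Pi.single i 1 ∧
        (∀ ℓ : ℕ, ℓ ≤ n → ℓ ≤ (i : ℕ) →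
          Submodule.map ((Matrix.mulVecLin b').comp (π.comp (Matrix.mulVecLin b)))
            (flagW k c ℓ) = ⊥) ∧
        (∀ ℓ : ℕ, ℓ ≤ n → (i : ℕ) < ℓ →
          Submodule.map ((Matrix.mulVecLin b').comp (π.comp (Matrix.mulVecLin b)))
            (flagW k c ℓ) = Submodule.span k {b'.mulVec (Pi.single i 1)}) ∧
        Submodule.span k {b'.mulVec (Pi.single i (1 : k))} ≤ flagW k c ((i : ℕ) + 1) ∧
        ∀ ℓ : ℕ, ℓ ≤ n →
          Submodule.map ((Matrix.mulVecLin b').comp (π.comp (Matrix.mulVecLin b)))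
            (flagW k c ℓ) ≤ flagW k c ℓ := by
  have hb : b.IsUpperTriangular := fun a c h => hbu a c h
  have hc := isFullCycleAt_inv_cycleIcc hij
  have hspan := span_mulVec_single_le_flagW (hb.of_mul_eq_one hbb') hc
  refine ⟨_, hc, linearIndependent_basisFam hb hbb' i j, span_range_basisFam hb hbb' i j,
    existsUnique_isPiMap hb hbb' i j, fun π hπ => ⟨?_, hπ.range_le hb hbb', hπ.map_single,
      fun ℓ _ => hπ.map_flagW_eq_bot hc, fun ℓ _ => hπ.map_flagW_eq_span hb hbb' hij hc, hspan,
      fun ℓ _ => ?_⟩⟩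
  · rintro ℓ (h | h)
    · exact hπ.map_single_of_lt hb hbb' hij h
    · exact hπ.map_single_of_gt hij h
  · rcases le_or_gt ℓ i with h | h
    · exact (hπ.map_flagW_eq_bot hc h).trans_le bot_le
    · exact (hπ.map_flagW_eq_span hb hbb' hij hc h).trans_le
        (hspan.trans (flagW_mono k _ h))
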